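/- Let S be a finite nonempty index set and let γ : S → ℝ satisfy 0 < γ_s < 1 for all s ∈ S. Then the supremum, over all λ : S → ℝ with ∑_{s∈S} λ_s²(1 − γ_s) > 0, of the ratio (∑_{s∈S} λ_s √γ_s)² / (∑_{s∈S} λ_s² (1 − γ_s)) equals ∑_{s∈S} γ_s/(1 − γ_s), and this supremum is attained (at λ_s = √γ_s/(1 − γ_s)). -/

import Mathlib

/-- The supremum of the signal-to-noise ratio
`(∑ s in S, lam s * √(γ s))^2 / (∑ s in S, (lam s)^2 * (1 - γ s))` over admissible
coefficients `lam` (those with positive noise variance) equals `∑ s in S, γ s / (1 - γ s)`,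
and it is attained, in particular at `lam s = √(γ s) / (1 - γ s)`. -/
theorem snr_isGreatest {ι : Type*} (S : Finset ι) (hS : S.Nonempty) (γ : ι → ℝ)
    (hγ : ∀ s ∈ S, 0 < γ s ∧ γ s < 1) :
    IsGreatest
      {r : ℝ | ∃ lam : ι → ℝ, 0 < ∑ s ∈ S, (lam s) ^ 2 * (1 - γ s) ∧
        r = (∑ s ∈ S, lam s * Real.sqrt (γ s)) ^ 2 / (∑ s ∈ S, (lam s) ^ 2 * (1 - γ s))}
      (∑ s ∈ S, γ s / (1 - γ s)) ∧
    (∑ s ∈ S, (Real.sqrt (γ s) / (1 - γ s)) * Real.sqrt (γ s)) ^ 2 /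
        (∑ s ∈ S, (Real.sqrt (γ s) / (1 - γ s)) ^ 2 * (1 - γ s)) =
      ∑ s ∈ S, γ s / (1 - γ s) := by
  have hnum : ∑ s ∈ S, (Real.sqrt (γ s) / (1 - γ s)) * Real.sqrt (γ s) =
      ∑ s ∈ S, γ s / (1 - γ s) :=
    Finset.sum_congr rfl fun s hs => by
      rw [div_mul_eq_mul_div, Real.mul_self_sqrt (hγ s hs).1.le]
  have hden : ∑ s ∈ S, (Real.sqrt (γ s) / (1 - γ s)) ^ 2 * (1 - γ s) =
      ∑ s ∈ S, γ s / (1 - γ s) :=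
    Finset.sum_congr rfl fun s hs => by
      have h : 1 - γ s ≠ 0 := (sub_pos.2 (hγ s hs).2).ne'
      rw [div_pow, Real.sq_sqrt (hγ s hs).1.le]
      field_simp
  have hpos : 0 < ∑ s ∈ S, γ s / (1 - γ s) :=
    Finset.sum_pos (fun s hs => div_pos (hγ s hs).1 (sub_pos.2 (hγ s hs).2)) hS
  have hopt : (∑ s ∈ S, (Real.sqrt (γ s) / (1 - γ s)) * Real.sqrt (γ s)) ^ 2 /
      (∑ s ∈ S, (Real.sqrt (γ s) / (1 - γ s)) ^ 2 * (1 - γ s)) =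
      ∑ s ∈ S, γ s / (1 - γ s) := by
    rw [hnum, hden, sq, mul_self_div_self]
  refine ⟨⟨⟨fun s => Real.sqrt (γ s) / (1 - γ s), hden ▸ hpos, hopt.symm⟩, ?_⟩, hopt⟩
  rintro _ ⟨lam, hlam, rfl⟩
  rw [div_le_iff₀ hlam]
  refine Finset.sum_sq_le_sum_mul_sum_of_sq_le_mul S
    (fun s hs => (div_pos (hγ s hs).1 (sub_pos.2 (hγ s hs).2)).le)
    (fun s hs => mul_nonneg (sq_nonneg _) (sub_pos.2 (hγ s hs).2).le) fun s hs => le_of_eq ?_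
  have h : 1 - γ s ≠ 0 := (sub_pos.2 (hγ s hs).2).ne'
  rw [mul_pow, Real.sq_sqrt (hγ s hs).1.le]
  field_simp
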